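/- (Hilbert's Nullstellensatz for quasi-commutative bijective skew PBW extensions.) Assume F is algebraically closed and let φ : F[y_1, …, y_n] → A be an injective ring homomorphism from the commutative polynomial ring in n variables over F whose image equals the center Z(A) of A. Then for every two-sided ideal I of A, setting J := φ^{-1}(I), one has ⟨φ(𝓘(𝓥(J)))⟩ ⊆ √I ⊆ I(V(I)), where ⟨φ(𝓘(𝓥(J)))⟩ is the two-sided ideal of A generated by φ(𝓘(𝓥(J))), 𝓥(J) := {p ∈ F^n : g(p) = 0 for all g ∈ J} and 𝓘(X) := {g ∈ F[y_1, …, y_n] : g(p) = 0 for all p ∈ X} are the classical vanishing set and vanishing ideal. -/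

import Mathlib

/-- The standard monomial `x^a = x 1 ^ a 1 ⋯ x n ^ a n`. -/
def smon {A : Type*} [Ring A] {n : ℕ} (x : Fin n → A) (a : Fin n → ℕ) : A :=
  (List.ofFn fun i => x i ^ a i).prod

/-- The two-sided ideal `⟨Z⟩` of `A` generated by `x 1 - ι (z 1), …, x n - ι (z n)`. -/
def pointIdeal {F A : Type*} [Field F] [Ring A] {n : ℕ} (ι : F →+* A) (x : Fin n → A)
    (Z : Fin n → F) : TwoSidedIdeal A :=
  TwoSidedIdeal.span {a | ∃ i, a = x i - ι (Z i)}

/-- `A` is a quasi-commutative bijective skew PBW extension of the field `F`,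
via the injective ring homomorphism `ι : F → A` and the variables `x 1, …, x n`. -/
structure IsQuasiCommSkewPBW {F A : Type*} [Field F] [Ring A] {n : ℕ}
    (ι : F →+* A) (x : Fin n → A) : Prop where
  inj : Function.Injective ι
  -- (1) the standard monomials form a basis of A as a left F-vector space
  basis : ∀ a : A, ∃! c : (Fin n → ℕ) →₀ F, a = c.sum fun α r => ι r * smon x α
  -- (2) field automorphisms σ_i of F with x_i ι(r) = ι(σ_i(r)) x_i
  sigma : ∃ σ : Fin n → F ≃+* F, ∀ (i : Fin n) (r : F), x i * ι r = ι (σ i r) * x i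
  -- (3) nonzero q_{ij} ∈ F with x_j x_i = ι(q_{ij}) x_i x_j for i < j
  q : ∃ q : Fin n → Fin n → F, ∀ i j : Fin n, i < j →
        q i j ≠ 0 ∧ x j * x i = ι (q i j) * (x i * x j)

/-- A two-sided ideal `P ⊊ A` is prime if `aAb ⊆ P` implies `a ∈ P` or `b ∈ P`. -/
def IsPrimeTwoSided {A : Type*} [Ring A] (P : TwoSidedIdeal A) : Prop :=
  P ≠ ⊤ ∧ ∀ a b : A, (∀ s : A, a * s * b ∈ P) → a ∈ P ∨ b ∈ P

/-- The classical vanishing set `𝓥(J) ⊆ F^n` of a set of commutative polynomials. -/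
def clV {F : Type*} [CommSemiring F] {n : ℕ} (J : Set (MvPolynomial (Fin n) F)) :
    Set (Fin n → F) :=
  {p | ∀ g ∈ J, MvPolynomial.eval p g = 0}

/-- The classical vanishing ideal `𝓘(X)` of a set of points `X ⊆ F^n`. -/
def clI {F : Type*} [CommSemiring F] {n : ℕ} (X : Set (Fin n → F)) :
    Set (MvPolynomial (Fin n) F) :=
  {g | ∀ p ∈ X, MvPolynomial.eval p g = 0}

/-- Modulo a point ideal every element is congruent to a scalar. -/
theorem IsQuasiCommSkewPBW.exists_sub_mem_pointIdeal {F A : Type*} [Field F] [Ring A] {n : ℕ}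
    {ι : F →+* A} {x : Fin n → A} (hA : IsQuasiCommSkewPBW ι x) (Z : Fin n → F) (a : A) :
    ∃ r : F, a - ι r ∈ pointIdeal ι x Z := by
  set π := (pointIdeal ι x Z).ringCon.mk'
  have mem_iff (b c : A) : b - c ∈ pointIdeal ι x Z ↔ π b = π c := by
    rw [← TwoSidedIdeal.rel_iff]
    exact (RingCon.eq _).symm
  have hx (i : Fin n) : π (x i) ∈ (π.comp ι).range :=
    ⟨Z i, ((mem_iff _ _).1 (TwoSidedIdeal.subset_span ⟨i, rfl⟩)).symm⟩
  have hmon (α : Fin n → ℕ) : π (smon x α) ∈ (π.comp ι).range := by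
    rw [smon, map_list_prod]
    refine list_prod_mem fun y hy => ?_
    obtain ⟨z, hz, rfl⟩ := List.mem_map.1 hy
    obtain ⟨i, rfl⟩ := List.mem_ofFn.1 hz
    rw [map_pow]
    exact pow_mem (hx i) _
  obtain ⟨c, hc, -⟩ := hA.basis a
  have ha : π a ∈ (π.comp ι).range := by
    rw [hc, Finsupp.sum, map_sum]
    refine sum_mem fun α _ => ?_
    rw [map_mul]
    exact mul_mem ⟨c α, rfl⟩ (hmon α)
  obtain ⟨r, hr⟩ := ha
  exact ⟨r, (mem_iff _ _).2 hr.symm⟩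

/-- A proper point ideal is prime. -/
theorem IsQuasiCommSkewPBW.isPrimeTwoSided_pointIdeal {F A : Type*} [Field F] [Ring A] {n : ℕ}
    {ι : F →+* A} {x : Fin n → A} (hA : IsQuasiCommSkewPBW ι x) {Z : Fin n → F}
    (hZ : pointIdeal ι x Z ≠ ⊤) : IsPrimeTwoSided (pointIdeal ι x Z) := by
  refine ⟨hZ, fun a b hab => ?_⟩
  obtain ⟨r, hr⟩ := hA.exists_sub_mem_pointIdeal Z a
  obtain ⟨s, hs⟩ := hA.exists_sub_mem_pointIdeal Z b
  have hmem : ι (r * s) ∈ pointIdeal ι x Z := by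
    have h := sub_mem (sub_mem (hab 1) (TwoSidedIdeal.mul_mem_right _ _ b hr))
      (TwoSidedIdeal.mul_mem_left _ (ι r) _ hs)
    convert h using 1
    rw [map_mul]
    noncomm_ring
  have hrs : r * s = 0 := by
    by_contra h0
    refine hZ ((TwoSidedIdeal.one_mem_iff _).1 ?_)
    have h := TwoSidedIdeal.mul_mem_left _ (ι (r * s)⁻¹) _ hmem
    rwa [← map_mul, inv_mul_cancel₀ h0, map_one] at h
  rcases mul_eq_zero.1 hrs with rfl | rfl
  · exact Or.inl (by simpa using hr)
  · exact Or.inr (by simpa using hs)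

/-- A central element with a power in a prime two-sided ideal lies in that ideal. -/
theorem IsPrimeTwoSided.mem_of_pow_mem {A : Type*} [Ring A] {P : TwoSidedIdeal A}
    (hP : IsPrimeTwoSided P) {a : A} (ha : a ∈ Set.center A) {k : ℕ} (hk : a ^ k ∈ P) :
    a ∈ P := by
  induction k with
  | zero =>
    rw [pow_zero] at hk
    exact absurd ((TwoSidedIdeal.one_mem_iff P).1 hk) hP.1
  | succ k ih =>
    refine (hP.2 a (a ^ k) fun s => ?_).elim id ih
    rw [(Set.mem_center_iff.1 ha).comm s, mul_assoc, ← pow_succ']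
    exact P.mul_mem_left _ _ hk

/-- Hilbert's Nullstellensatz, in terms of `clV` and `clI`. -/
theorem exists_pow_mem_of_mem_clI_clV {F : Type*} [Field F] [IsAlgClosed F] {n : ℕ}
    (J : Ideal (MvPolynomial (Fin n) F)) {g : MvPolynomial (Fin n) F}
    (hg : g ∈ clI (clV (J : Set (MvPolynomial (Fin n) F)))) : ∃ k : ℕ, g ^ k ∈ J := by
  change g ∈ J.radical
  rw [← MvPolynomial.vanishingIdeal_zeroLocus_eq_radical (K := F)]
  intro p hp
  rw [MvPolynomial.aeval_eq_eval]
  refine hg p fun f hf => ?_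
  rw [← MvPolynomial.aeval_eq_eval]
  exact hp f hf

/-- Hilbert's Nullstellensatz for quasi-commutative bijective skew PBW extensions. -/
theorem stmt18 {F A : Type*} [Field F] [IsAlgClosed F] [Ring A] {n : ℕ}
    (ι : F →+* A) (x : Fin n → A) (hA : IsQuasiCommSkewPBW ι x)
    -- the center Z(A) is a polynomial ring in n variables over F
    (φ : MvPolynomial (Fin n) F →+* A) (hφ : Function.Injective φ)
    (hrange : Set.range φ = Set.center A)
    (I : TwoSidedIdeal A) :
    -- ⟨φ(𝓘(𝓥(J)))⟩ ⊆ √I, where J = φ⁻¹(I)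
    (TwoSidedIdeal.span (φ '' clI (clV {g | φ g ∈ I})) ≤
      sInf {P : TwoSidedIdeal A | IsPrimeTwoSided P ∧ I ≤ P})
    -- √I ⊆ I(V(I))
    ∧ ∀ f : A, f ∈ sInf {P : TwoSidedIdeal A | IsPrimeTwoSided P ∧ I ≤ P} →
        ∀ Z : Fin n → F, I ≤ pointIdeal ι x Z → f ∈ pointIdeal ι x Z := by
  refine ⟨TwoSidedIdeal.span_le.2 ?_, fun f hf Z hZ => ?_⟩
  · rintro _ ⟨g, hg, rfl⟩
    obtain ⟨k, hk⟩ := exists_pow_mem_of_mem_clI_clV (I.asIdeal.comap φ) hg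
    refine (TwoSidedIdeal.mem_sInf A).2 fun P hP => ?_
    refine hP.1.mem_of_pow_mem (hrange ▸ Set.mem_range_self g) (k := k) (hP.2 ?_)
    rw [← map_pow]
    exact hk
  · by_cases h : pointIdeal ι x Z = ⊤
    · rw [h]
      trivial
    · exact (TwoSidedIdeal.mem_sInf A).1 hf _ ⟨hA.isPrimeTwoSided_pointIdeal h, hZ⟩
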